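/- arXiv:2512.13537 — 2 statements merged into one kernel-verified Lean document; each statement's English description precedes it below -/
import Mathlib

section
/- Assume additionally that F̂ is strictly concave on (0,∞) and that f(x_0) > f*. Suppose a ∈ (0,1) and the parameter c satisfies both F̂'(f* + c) (f(x_0) − f*) ≤ a r_0 and F̂(f* + c) ≥ L η r_0 / (4(1 − a)). Then r_0 > F_0 − F* and η < η_{r_0} := 4 F* (r_0 − F_0 + F*)/(L r_0^2), where F* = F̂(f* + c); consequently the gAEGD energies satisfy inf_k r_k > 0. -/
/-- A concave function lies below its tangent line at a point of differentiability. -/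
lemma ConcaveOn.le_tangent {S : Set ℝ} {g : ℝ → ℝ} (hg : ConcaveOn ℝ S g) {u v : ℝ}
    (hu : u ∈ S) (hv : v ∈ S) (hd : DifferentiableAt ℝ g u) :
    g v ≤ g u + deriv g u * (v - u) := by
  rcases lt_trichotomy u v with h | rfl | h
  · have := hg.slope_le_deriv hu hv h hd
    rw [slope_def_field, div_le_iff₀ (sub_pos.2 h)] at this
    linarith
  · simp
  · have := hg.deriv_le_slope hv hu h hd
    rw [slope_def_field, le_div_iff₀ (sub_pos.2 h)] at this
    linarith

/-- The descent lemma: a function with `L`-Lipschitz gradient is bounded above by its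
first-order expansion plus `L / 2 * ‖v‖ ^ 2`. -/
lemma le_add_inner_gradient_add_sq {E : Type*} [NormedAddCommGroup E] [InnerProductSpace ℝ E]
    [CompleteSpace E] {f : E → ℝ} (hf : Differentiable ℝ f) {L : ℝ}
    (hLip : ∀ y z, ‖gradient f y - gradient f z‖ ≤ L * ‖y - z‖) (y v : E) :
    f (y + v) ≤ f y + inner ℝ (gradient f y) v + L / 2 * ‖v‖ ^ 2 := by
  have hline : ∀ t : ℝ, HasDerivAt (fun t : ℝ => f (y + t • v) - t * inner ℝ (gradient f y) v
      - L / 2 * ‖v‖ ^ 2 * t ^ 2)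
      (inner ℝ (gradient f (y + t • v)) v - inner ℝ (gradient f y) v
        - L / 2 * ‖v‖ ^ 2 * (2 * t)) t := by
    intro t
    have h1 : HasDerivAt (fun t : ℝ => y + t • v) v t := by
      simpa using ((hasDerivAt_id t).smul_const v).const_add y
    have h2 := (hf (y + t • v)).hasGradientAt.hasFDerivAt.comp_hasDerivAt t h1
    have h3 := (hasDerivAt_id t).mul_const (inner ℝ (gradient f y) v)
    have h4 := ((hasDerivAt_id t).pow 2).const_mul (L / 2 * ‖v‖ ^ 2)
    refine ((h2.sub h3).sub h4).congr_deriv ?_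
    simp
  have hanti := antitoneOn_of_deriv_nonpos (convex_Icc (0 : ℝ) 1)
    (fun t _ => (hline t).continuousAt.continuousWithinAt)
    (fun t _ => (hline t).differentiableAt.differentiableWithinAt) (fun t ht => by
      rw [interior_Icc] at ht
      rw [(hline t).deriv, ← inner_sub_left]
      have hcs := real_inner_le_norm (gradient f (y + t • v) - gradient f y) v
      have hg := hLip (y + t • v) y
      rw [add_sub_cancel_left, norm_smul, Real.norm_of_nonneg ht.1.le] at hg
      have := mul_le_mul_of_nonneg_right hg (norm_nonneg v)
      linarith)
  have h := hanti (Set.left_mem_Icc.2 zero_le_one) (Set.right_mem_Icc.2 zero_le_one) zero_le_one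
  simp only [one_smul, zero_smul, add_zero, one_mul, zero_mul, one_pow] at h
  linarith

/-- One-step decrease of the modified energy `F - r + L * η / (4 * Fs) * r ^ 2`, where `Fs` is a
positive lower bound for `F`. -/
lemma energy_step {L η Fs F F₁ P G r r₁ t D : ℝ} (hL : 0 < L) (hη : 0 < η) (hFs : 0 < Fs)
    (hF : Fs ≤ F) (hP : 0 < P) (hG : 0 ≤ G) (hr : 0 < r)
    (hr₁ : r₁ = r / (1 + η * (P / F) * G)) (ht : t = η * (r₁ / F))
    (hD : D ≤ -t * G + L / 2 * (t ^ 2 * G)) (hF₁ : F₁ ≤ F + P * D) :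
    F₁ - r₁ + L * η / (4 * Fs) * r₁ ^ 2 ≤ F - r + L * η / (4 * Fs) * r ^ 2 := by
  have hF0 : 0 < F := hFs.trans_le hF
  have hden : 0 < 1 + η * (P / F) * G := by positivity
  have hr₁pos : 0 < r₁ := hr₁ ▸ div_pos hr hden
  have hdrop : P * t * G = r - r₁ := by
    rw [eq_div_iff hden.ne'] at hr₁
    rw [← hr₁, ht]
    ring
  have ht0 : 0 < t := by rw [ht]; positivity
  have hmono : 0 ≤ r - r₁ := by rw [← hdrop]; positivity
  have hle : t ≤ η * (r₁ / Fs) := by rw [ht]; gcongr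
  have hPD := mul_le_mul_of_nonneg_left hD hP.le
  have hquad : P * (-t * G + L / 2 * (t ^ 2 * G)) = -(r - r₁) + L / 2 * t * (r - r₁) := by
    rw [← hdrop]; ring
  have hstep : L / 2 * t * (r - r₁) ≤ L / 2 * (η * (r₁ / Fs)) * (r - r₁) := by gcongr
  have hconst : L / 2 * (η * (r₁ / Fs)) = 2 * (L * η / (4 * Fs)) * r₁ := by
    field_simp; ring
  rw [hconst] at hstep
  have hA : 0 ≤ L * η / (4 * Fs) * (r - r₁) ^ 2 := by positivity
  linarith


/-- Sufficient conditions on `c`: if `F̂` is strictly concave, `f(x_0) > f*`,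
`a ∈ (0,1)`, `F̂'(f* + c)(f(x_0) − f*) ≤ a r_0` and `F̂(f* + c) ≥ Lη r_0/(4(1−a))`,
then `r_0 > F_0 − F*` and `η < η_{r_0}`, and consequently `inf_k r_k > 0`. -/
theorem gAEGD_robustness_in_c
    {d : ℕ} (hd : 1 ≤ d)
    (f : EuclideanSpace ℝ (Fin d) → ℝ) (hf : Differentiable ℝ f)
    (L : ℝ) (hL : 0 < L)
    (hLip : ∀ y z, ‖gradient f y - gradient f z‖ ≤ L * ‖y - z‖)
    (fstar : ℝ) (hfstar : IsGLB (Set.range f) fstar)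
    (Fhat : ℝ → ℝ) (hFdiff : Differentiable ℝ Fhat)
    (hFmono : StrictMonoOn Fhat (Set.Ioi (0 : ℝ)))
    (hFconc : ConcaveOn ℝ (Set.Ioi (0 : ℝ)) Fhat)
    (hFpos : ∀ s : ℝ, 0 < s → 0 < Fhat s)
    (hF'pos : ∀ s : ℝ, 0 < s → 0 < deriv Fhat s)
    (c : ℝ) (hc : 0 < fstar + c)
    (η : ℝ) (hη : 0 < η)
    (x : ℕ → EuclideanSpace ℝ (Fin d)) (r : ℕ → ℝ)
    (hr0 : 0 < r 0)
    (hrec_r : ∀ k : ℕ, r (k + 1) = r k /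
      (1 + η * (deriv Fhat (f (x k) + c) / Fhat (f (x k) + c)) * ‖gradient f (x k)‖ ^ 2))
    (hrec_x : ∀ k : ℕ, x (k + 1) =
      x k - (η * (r (k + 1) / Fhat (f (x k) + c))) • gradient f (x k))
    (hFsconc : StrictConcaveOn ℝ (Set.Ioi (0 : ℝ)) Fhat)
    (hgap : fstar < f (x 0))
    (a : ℝ) (ha : a ∈ Set.Ioo (0 : ℝ) 1)
    (hc1 : deriv Fhat (fstar + c) * (f (x 0) - fstar) ≤ a * r 0)
    (hc2 : L * η * r 0 / (4 * (1 - a)) ≤ Fhat (fstar + c)) :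
    Fhat (f (x 0) + c) - Fhat (fstar + c) < r 0 ∧
    η < 4 * Fhat (fstar + c) * (r 0 - Fhat (f (x 0) + c) + Fhat (fstar + c))
      / (L * (r 0) ^ 2) ∧
    ∃ rstar > 0, ∀ k : ℕ, rstar ≤ r k := by
  have hlow : ∀ y, fstar ≤ f y := fun y => hfstar.1 ⟨y, rfl⟩
  have hpos : ∀ y, 0 < f y + c := fun y => by linarith [hlow y]
  have hFs := hFpos _ hc
  have hFle : ∀ y, Fhat (fstar + c) ≤ Fhat (f y + c) := fun y =>
    hFmono.monotoneOn hc (hpos y) (by linarith [hlow y])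
  obtain ⟨ha0, ha1⟩ := ha
  have htan : Fhat (f (x 0) + c) - Fhat (fstar + c)
      < deriv Fhat (fstar + c) * (f (x 0) - fstar) := by
    have h := hFsconc.slope_lt_deriv hc (hpos (x 0)) (by linarith) (hFdiff (fstar + c))
    rw [slope_def_field, div_lt_iff₀ (by linarith)] at h
    linarith
  have har : a * r 0 < r 0 := by nlinarith
  have hgapF : Fhat (f (x 0) + c) - Fhat (fstar + c) < r 0 := by linarith
  have hηlt : η < 4 * Fhat (fstar + c) * (r 0 - Fhat (f (x 0) + c) + Fhat (fstar + c))
      / (L * (r 0) ^ 2) := by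
    rw [lt_div_iff₀ (by positivity)]
    rw [div_le_iff₀ (by linarith)] at hc2
    have h1 := mul_le_mul_of_nonneg_right hc2 hr0.le
    have h2 : 4 * Fhat (fstar + c) * ((1 - a) * r 0)
        < 4 * Fhat (fstar + c) * (r 0 - Fhat (f (x 0) + c) + Fhat (fstar + c)) :=
      mul_lt_mul_of_pos_left (by linarith) (by linarith)
    linarith
  refine ⟨hgapF, hηlt, ?_⟩
  have hrpos : ∀ k, 0 < r k := by
    intro k
    induction k with
    | zero => exact hr0
    | succ k ih =>
      have h1 := hFpos _ (hpos (x k))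
      have h2 := hF'pos _ (hpos (x k))
      rw [hrec_r]
      positivity
  have henergy : Antitone fun k => Fhat (f (x k) + c) - r k
      + L * η / (4 * Fhat (fstar + c)) * r k ^ 2 := by
    refine antitone_nat_of_succ_le fun k => ?_
    refine energy_step hL hη hFs (hFle _) (hF'pos _ (hpos (x k))) (sq_nonneg _) (hrpos k)
      (hrec_r k) rfl (D := f (x (k + 1)) - f (x k)) ?_ ?_
    · have h := le_add_inner_gradient_add_sq hf hLip (x k)
        (-(η * (r (k + 1) / Fhat (f (x k) + c))) • gradient f (x k))
      rw [real_inner_smul_right, real_inner_self_eq_norm_sq, norm_smul, mul_pow,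
        Real.norm_eq_abs, sq_abs, neg_sq, neg_smul, ← sub_eq_add_neg, ← hrec_x] at h
      linarith
    · have h := hFconc.le_tangent (hpos (x k)) (hpos (x (k + 1))) (hFdiff _)
      rwa [add_sub_add_right_eq_sub] at h
  refine ⟨r 0 - Fhat (f (x 0) + c) + Fhat (fstar + c)
    - L * η / (4 * Fhat (fstar + c)) * r 0 ^ 2, ?_, fun k => ?_⟩
  · rw [lt_div_iff₀ (by positivity)] at hηlt
    rw [gt_iff_lt, sub_pos, div_mul_eq_mul_div, div_lt_iff₀ (by positivity)]
    linarith
  · have h := henergy (Nat.zero_le k)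
    have hA : 0 ≤ L * η / (4 * Fhat (fstar + c)) * r k ^ 2 := by positivity
    have := hFle (x k)
    dsimp only at h
    linarith
end

section
/- Set F* = F̂(f* + c) and F̄ = F_0 + L η r_0^2 / (4 F*). Suppose r* > 0 satisfies r_k ≥ r* for all k ≥ 0, and suppose r_0 ≤ F* / (L η). Then for every ε > 0 and every natural number N ≥ 1 + ⌈(1/ε) · 2 F̄ (f(x_0) − f*) / (η r*)⌉, the gAEGD iterates satisfy min_{0 ≤ k ≤ N} ‖∇f(x_k)‖^2 < ε. -/
/-- The quadratic upper bound for a function with `L`-Lipschitz gradient. -/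
theorem le_add_inner_gradient_add_sq_of_lipschitz_gradient
    {E : Type*} [NormedAddCommGroup E] [InnerProductSpace ℝ E] [CompleteSpace E]
    {f : E → ℝ} (hf : Differentiable ℝ f) {L : ℝ}
    (hLip : ∀ y z, ‖gradient f y - gradient f z‖ ≤ L * ‖y - z‖) (x v : E) :
    f (x + v) ≤ f x + inner ℝ (gradient f x) v + L / 2 * ‖v‖ ^ 2 := by
  set φ : ℝ → ℝ := fun t =>
    f (x + t • v) - t * inner ℝ (gradient f x) v - L / 2 * ‖v‖ ^ 2 * t ^ 2 with hφ
  have hderiv (t : ℝ) : HasDerivAt φ (inner ℝ (gradient f (x + t • v)) v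
      - inner ℝ (gradient f x) v - L / 2 * ‖v‖ ^ 2 * (2 * t)) t := by
    have hline : HasDerivAt (fun t : ℝ => x + t • v) v t := by
      simpa using ((hasDerivAt_id t).smul_const v).const_add x
    have hcomp : HasDerivAt (fun t : ℝ => f (x + t • v))
        (inner ℝ (gradient f (x + t • v)) v) t := by
      have h := (hf (x + t • v)).hasFDerivAt.comp_hasDerivAt t hline
      rwa [← inner_gradient_left] at h
    have hlin : HasDerivAt (fun t : ℝ => t * inner ℝ (gradient f x) v)
        (inner ℝ (gradient f x) v) t := by
      simpa using (hasDerivAt_id t).mul_const (inner ℝ (gradient f x) v)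
    have hsq : HasDerivAt (fun t : ℝ => L / 2 * ‖v‖ ^ 2 * t ^ 2)
        (L / 2 * ‖v‖ ^ 2 * (2 * t)) t := by
      simpa using (hasDerivAt_pow 2 t).const_mul (L / 2 * ‖v‖ ^ 2)
    exact (hcomp.sub hlin).sub hsq
  have hanti : AntitoneOn φ (Set.Icc 0 1) := by
    refine antitoneOn_of_deriv_nonpos (convex_Icc 0 1)
      (fun t _ => (hderiv t).continuousAt.continuousWithinAt)
      (fun t _ => (hderiv t).differentiableAt.differentiableWithinAt) fun t ht => ?_
    rw [interior_Icc] at ht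
    rw [(hderiv t).deriv, ← inner_sub_left]
    have hgrad := hLip (x + t • v) x
    rw [add_sub_cancel_left, norm_smul, Real.norm_of_nonneg ht.1.le] at hgrad
    have hinner := (real_inner_le_norm (gradient f (x + t • v) - gradient f x) v).trans
      (mul_le_mul_of_nonneg_right hgrad (norm_nonneg v))
    linarith
  have h01 := hanti (Set.left_mem_Icc.2 zero_le_one) (Set.right_mem_Icc.2 zero_le_one) zero_le_one
  simp only [hφ, one_smul, zero_smul, add_zero] at h01
  linarith

/-- A gradient step of length at most `1 / L` decreases the function by at least half the step
length times the squared gradient norm. -/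
theorem gradient_step_le_sub_of_lipschitz_gradient
    {E : Type*} [NormedAddCommGroup E] [InnerProductSpace ℝ E] [CompleteSpace E]
    {f : E → ℝ} (hf : Differentiable ℝ f) {L : ℝ}
    (hLip : ∀ y z, ‖gradient f y - gradient f z‖ ≤ L * ‖y - z‖) (x : E)
    {s : ℝ} (hs : 0 ≤ s) (hsL : L * s ≤ 1) :
    f (x - s • gradient f x) ≤ f x - s / 2 * ‖gradient f x‖ ^ 2 := by
  have h := le_add_inner_gradient_add_sq_of_lipschitz_gradient hf hLip x (-(s • gradient f x))
  rw [← sub_eq_add_neg, inner_neg_right, real_inner_smul_right, real_inner_self_eq_norm_sq,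
    norm_neg, norm_smul, Real.norm_of_nonneg hs] at h
  have hmul : 0 ≤ (1 - L * s) * (s * ‖gradient f x‖ ^ 2) :=
    mul_nonneg (by linarith) (by positivity)
  linarith


/-- Non-asymptotic convergence, case `r_0 ≤ F*/(Lη)`: if `r_k ≥ r* > 0` for all `k`,
then for every `ε > 0` and every `N ≥ 1 + ⌈(1/ε) · 2F̄(f(x_0) − f*)/(η r*)⌉`,
`min_{0 ≤ k ≤ N} ‖∇f(x_k)‖^2 < ε`. -/
theorem gAEGD_nonasymptotic_convergence_small_r0
    {d : ℕ} (hd : 1 ≤ d)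
    (f : EuclideanSpace ℝ (Fin d) → ℝ) (hf : Differentiable ℝ f)
    (L : ℝ) (hL : 0 < L)
    (hLip : ∀ y z, ‖gradient f y - gradient f z‖ ≤ L * ‖y - z‖)
    (fstar : ℝ) (hfstar : IsGLB (Set.range f) fstar)
    (Fhat : ℝ → ℝ) (hFdiff : Differentiable ℝ Fhat)
    (hFmono : StrictMonoOn Fhat (Set.Ioi (0 : ℝ)))
    (hFconc : ConcaveOn ℝ (Set.Ioi (0 : ℝ)) Fhat)
    (hFpos : ∀ s : ℝ, 0 < s → 0 < Fhat s)
    (hF'pos : ∀ s : ℝ, 0 < s → 0 < deriv Fhat s)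
    (c : ℝ) (hc : 0 < fstar + c)
    (η : ℝ) (hη : 0 < η)
    (x : ℕ → EuclideanSpace ℝ (Fin d)) (r : ℕ → ℝ)
    (hr0 : 0 < r 0)
    (hrec_r : ∀ k : ℕ, r (k + 1) = r k /
      (1 + η * (deriv Fhat (f (x k) + c) / Fhat (f (x k) + c)) * ‖gradient f (x k)‖ ^ 2))
    (hrec_x : ∀ k : ℕ, x (k + 1) =
      x k - (η * (r (k + 1) / Fhat (f (x k) + c))) • gradient f (x k))
    (rstar : ℝ) (hrstar : 0 < rstar) (hrlow : ∀ k : ℕ, rstar ≤ r k)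
    (hr0small : r 0 ≤ Fhat (fstar + c) / (L * η)) :
    ∀ ε : ℝ, 0 < ε → ∀ N : ℕ,
      1 + ((⌈(1 / ε) * (2 * (Fhat (f (x 0) + c) + L * η * (r 0) ^ 2 / (4 * Fhat (fstar + c)))
        * (f (x 0) - fstar) / (η * rstar))⌉ : ℤ) : ℝ) ≤ (N : ℝ) →
      ∃ k ≤ N, ‖gradient f (x k)‖ ^ 2 < ε := by
  intro ε hε N hN
  by_contra! hcon
  have hfs (y) : fstar ≤ f y := hfstar.1 ⟨y, rfl⟩
  have hpos (y) : 0 < f y + c := by linarith [hfs y]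
  have hFs : 0 < Fhat (fstar + c) := hFpos _ hc
  have hFle (y) : Fhat (fstar + c) ≤ Fhat (f y + c) :=
    hFmono.monotoneOn hc (hpos y) (by linarith [hfs y])
  have hrpos (k) : 0 < r k := hrstar.trans_le (hrlow k)
  have hranti : Antitone r := antitone_nat_of_succ_le fun k => by
    rw [hrec_r k]
    refine div_le_self (hrpos k).le (le_add_of_nonneg_right ?_)
    have hF := hFpos _ (hpos (x k))
    have hF' := hF'pos _ (hpos (x k))
    positivity
  have hstep (k) : f (x (k + 1)) ≤ f (x k)
      - η * (r (k + 1) / Fhat (f (x k) + c)) / 2 * ‖gradient f (x k)‖ ^ 2 := by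
    have hF := hFpos _ (hpos (x k))
    have hr := hrpos (k + 1)
    rw [hrec_x k]
    refine gradient_step_le_sub_of_lipschitz_gradient hf hLip (x k) (by positivity) ?_
    rw [le_div_iff₀ (by positivity)] at hr0small
    rw [← mul_assoc, mul_div_assoc', div_le_one hF]
    calc L * η * r (k + 1) ≤ r 0 * (L * η) := by
          rw [mul_comm]
          gcongr
          exact hranti (Nat.zero_le _)
      _ ≤ Fhat (f (x k) + c) := hr0small.trans (hFle _)
  have hfanti : Antitone fun k => f (x k) := antitone_nat_of_succ_le fun k => by
    have hF := hFpos _ (hpos (x k))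
    have hr := hrpos (k + 1)
    have hdec : 0 ≤ η * (r (k + 1) / Fhat (f (x k) + c)) / 2 * ‖gradient f (x k)‖ ^ 2 := by
      positivity
    linarith [hstep k]
  set B := Fhat (f (x 0) + c) + L * η * (r 0) ^ 2 / (4 * Fhat (fstar + c)) with hB
  have hFB (k) : Fhat (f (x k) + c) ≤ B := by
    have hle : Fhat (f (x k) + c) ≤ Fhat (f (x 0) + c) :=
      hFmono.monotoneOn (hpos _) (hpos _) (by linarith [hfanti (Nat.zero_le k)])
    have hextra : 0 ≤ L * η * (r 0) ^ 2 / (4 * Fhat (fstar + c)) := by positivity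
    linarith
  have hBpos : 0 < B := (hFpos _ (hpos (x 0))).trans_le (hFB 0)
  have hsum (m : ℕ) (hm : m ≤ N + 1) :
      f (x m) ≤ f (x 0) - m * (η * (rstar / B) / 2 * ε) := by
    induction m with
    | zero => simp
    | succ m ih =>
      have hF := hFpos _ (hpos (x m))
      have hdec : η * (rstar / B) / 2 * ε ≤
          η * (r (m + 1) / Fhat (f (x m) + c)) / 2 * ‖gradient f (x m)‖ ^ 2 := by
        have hr := hrpos (m + 1)
        gcongr
        · exact hrlow _
        · exact hFB m
        · exact hcon m (by omega)
      push_cast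
      linarith [ih (by omega), hstep m]
  have htotal : ((N : ℝ) + 1) * (η * (rstar / B) / 2 * ε) ≤ f (x 0) - fstar := by
    have h := hsum (N + 1) le_rfl
    push_cast at h
    linarith [hfs (x (N + 1))]
  have hbound : (N : ℝ) + 1 ≤ (1 / ε) * (2 * B * (f (x 0) - fstar) / (η * rstar)) := by
    have hq : 0 < η * (rstar / B) / 2 * ε := by positivity
    refine ((le_div_iff₀ hq).2 htotal).trans_eq ?_
    field_simp
  linarith [Int.le_ceil ((1 / ε) * (2 * B * (f (x 0) - fstar) / (η * rstar)))]
end
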